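/- arXiv:2402.04685 — 5 statements merged into one kernel-verified Lean document; each statement's English description precedes it below -/
import Mathlib

section
/- Let K, N, L be positive integers, H ∈ ℝ^{2K×2N}, s ∈ ℝ^{2K}, V_k ∈ ℝ^{2L×2N} for k = 1,…,K, and let Λ ∈ ℝ^{2K×2K} be invertible. Let β_k ≥ 0, σ² > 0, P_T > 0. For γ ∈ ℝ^K with all γ_k > 0 write Γ(γ) = I₂ ⊗ diag(γ₁,…,γ_K). Define the feasible set S = {(x,γ) : x ∈ ℝ^{2N}, γ ∈ ℝ^K, γ_k > 0 for all k, every entry of Λ⁻¹(H·x − Γ(γ)·s) is nonnegative, and ‖x‖₂² ≤ P_T}, and the objective F(x,γ) = min over k of γ_k² / (β_k²‖V_k x‖₂² + σ²). Then for every (x,γ) ∈ S with ‖x‖₂² < P_T there exists (x′,γ′) ∈ S with F(x′,γ′) > F(x,γ); consequently, every maximizer of F on S satisfies ‖x‖₂² = P_T. -/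
open Matrix

/-- Scaling by a factor greater than one strictly increases a ratio with positive noise term. -/
theorem sq_div_lt_scaled_sq_div {c g b q σ2 : ℝ} (hc : 1 < c ^ 2) (hg : 0 < g) (hq : 0 ≤ q)
    (hσ : 0 < σ2) :
    g ^ 2 / (b ^ 2 * q + σ2) < (c * g) ^ 2 / (b ^ 2 * (c ^ 2 * q) + σ2) := by
  have hbq : 0 ≤ b ^ 2 * q := by positivity
  rw [div_lt_div_iff₀ (by positivity) (by positivity)]
  have h : 0 < g ^ 2 * (σ2 * (c ^ 2 - 1)) :=
    mul_pos (by positivity) (mul_pos hσ (by linarith))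
  linarith

theorem sum_smul_sq {ι : Type*} [Fintype ι] (c : ℝ) (x : ι → ℝ) :
    ∑ i, (c • x) i ^ 2 = c ^ 2 * ∑ i, x i ^ 2 := by
  simp [mul_pow, Finset.mul_sum]

theorem exists_scaling_sq_mul_le {S P : ℝ} (hS : 0 ≤ S) (hSP : S < P) :
    ∃ c : ℝ, 0 < c ∧ 1 < c ^ 2 ∧ c ^ 2 * S ≤ P := by
  have hP : 0 < P := hS.trans_lt hSP
  have hd : 0 < (P - S) / P := div_pos (by linarith) hP
  refine ⟨√(1 + (P - S) / P), Real.sqrt_pos.2 (by linarith), ?_, ?_⟩ <;>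
    rw [Real.sq_sqrt (by linarith)]
  · linarith
  · have h : (P - S) / P * S ≤ (P - S) / P * P := mul_le_mul_of_nonneg_left hSP.le hd.le
    rw [div_mul_cancel₀ _ hP.ne'] at h
    linarith

/-- In the robust SINR balancing problem, any feasible point with
`‖x‖₂² < P_T` can be strictly improved; consequently every maximizer uses full power. -/
theorem stmt5 {K N L : ℕ} (hK : 0 < K) (hN : 0 < N) (hL : 0 < L)
    (H : Matrix (Fin K ⊕ Fin K) (Fin N ⊕ Fin N) ℝ)
    (s : Fin K ⊕ Fin K → ℝ)
    (V : Fin K → Matrix (Fin L ⊕ Fin L) (Fin N ⊕ Fin N) ℝ)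
    (Λ : Matrix (Fin K ⊕ Fin K) (Fin K ⊕ Fin K) ℝ) (hΛ : IsUnit Λ)
    (β : Fin K → ℝ) (hβ : ∀ k, 0 ≤ β k)
    (σ2 PT : ℝ) (hσ : 0 < σ2) (hPT : 0 < PT)
    (Feas : (Fin N ⊕ Fin N → ℝ) → (Fin K → ℝ) → Prop)
    (hFeas : ∀ x γ, Feas x γ ↔
      (∀ k, 0 < γ k) ∧
      (∀ i, 0 ≤ (Λ⁻¹ *ᵥ (H *ᵥ x -
        (Matrix.fromBlocks (Matrix.diagonal γ) 0 0 (Matrix.diagonal γ)) *ᵥ s)) i) ∧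
      (∑ i, x i ^ 2 ≤ PT))
    (F : (Fin N ⊕ Fin N → ℝ) → (Fin K → ℝ) → ℝ)
    (hF : ∀ x γ, F x γ =
      ⨅ k : Fin K, γ k ^ 2 / ((β k) ^ 2 * (∑ j, ((V k *ᵥ x) j) ^ 2) + σ2)) :
    (∀ x γ, Feas x γ → (∑ i, x i ^ 2 < PT) →
      ∃ x' γ', Feas x' γ' ∧ F x γ < F x' γ') ∧
    (∀ x γ, Feas x γ → (∀ x' γ', Feas x' γ' → F x' γ' ≤ F x γ) →
      ∑ i, x i ^ 2 = PT) := by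
  have improve : ∀ x γ, Feas x γ → (∑ i, x i ^ 2 < PT) →
      ∃ x' γ', Feas x' γ' ∧ F x γ < F x' γ' := by
    intro x γ hx hlt
    obtain ⟨hγ, hCI, -⟩ := (hFeas x γ).1 hx
    obtain ⟨c, hc, hc1, hcP⟩ :=
      exists_scaling_sq_mul_le (Finset.sum_nonneg fun i _ => sq_nonneg (x i)) hlt
    refine ⟨c • x, c • γ, (hFeas _ _).2 ⟨fun k => mul_pos hc (hγ k), fun i => ?_, ?_⟩, ?_⟩
    · have hΓ : fromBlocks (diagonal (c • γ)) 0 0 (diagonal (c • γ)) =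
          c • fromBlocks (diagonal γ) 0 0 (diagonal γ) := by
        rw [fromBlocks_smul, diagonal_smul, smul_zero]
      rw [hΓ, mulVec_smul, smul_mulVec, ← smul_sub, mulVec_smul]
      exact mul_nonneg hc.le (hCI i)
    · rwa [sum_smul_sq]
    · have : Nonempty (Fin K) := ⟨⟨0, hK⟩⟩
      rw [hF, hF]
      obtain ⟨k, hk⟩ := exists_eq_ciInf_of_finite (f := fun k : Fin K =>
        (c • γ) k ^ 2 / ((β k) ^ 2 * (∑ j, ((V k *ᵥ (c • x)) j) ^ 2) + σ2))
      rw [← hk]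
      refine (ciInf_le (Set.finite_range _).bddBelow k).trans_lt ?_
      rw [mulVec_smul, sum_smul_sq]
      exact sq_div_lt_scaled_sq_div hc1 (hγ k)
        (Finset.sum_nonneg fun j _ => sq_nonneg _) hσ
  refine ⟨improve, fun x γ hx hmax => ?_⟩
  by_contra hne
  obtain ⟨x', γ', hx', hlt⟩ := improve x γ hx (lt_of_le_of_ne ((hFeas x γ).1 hx).2.2 hne)
  exact (hmax x' γ' hx').not_gt hlt
end

section
/- Let K and p be positive integers, A ∈ ℝ^{p×2K}, Λ ∈ ℝ^{2K×2K}, and s ∈ ℝ^{2K} with s_i ≠ 0 for every i. Assume (i) AᵀA is a diagonal matrix, and (ii) for every δ ∈ ℝ^{2K} with δ ⪰ 0 (all entries nonnegative) and every index i, s_i·(Λδ)_i ≥ 0. Then for every δ ⪰ 0 one has ‖A(s + Λδ)‖₂² ≥ ‖A·s‖₂²; that is, δ = 0 attains the minimum of the nonnegative least squares problem min_{δ⪰0} ‖A(s + Λδ)‖₂². -/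
open Matrix

/-- If the columns of `A` are pairwise orthogonal, then `‖A v‖₂²` is the sum of the squares of the
entries of `v`, weighted by the squared column norms. -/
theorem sum_sq_mulVec_of_isDiag {m n : Type*} [Fintype m] [Fintype n]
    {A : Matrix m n ℝ} (hdiag : (Aᵀ * A).IsDiag) (v : n → ℝ) :
    ∑ j, ((A *ᵥ v) j) ^ 2 = ∑ i, (Aᵀ * A) i i * v i ^ 2 := by
  classical
  calc ∑ j, ((A *ᵥ v) j) ^ 2 = v ⬝ᵥ (Aᵀ * A) *ᵥ v := by
        rw [← mulVec_mulVec, dotProduct_mulVec, vecMul_transpose]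
        simp only [dotProduct, sq]
    _ = ∑ i, (Aᵀ * A) i i * v i ^ 2 := by
        conv_lhs => rw [← hdiag.diagonal_diag]
        refine Finset.sum_congr rfl fun i _ => ?_
        rw [mulVec_diagonal, diag_apply]
        ring

/-- Lemma 1: If `AᵀA` is diagonal and `s_i·(Λδ)_i ≥ 0` for every `δ ⪰ 0`, then
`δ = 0` solves the NNLS problem `min_{δ⪰0} ‖A(s + Λδ)‖₂²`. -/
theorem stmt6 {K p : ℕ} (hK : 0 < K) (hp : 0 < p)
    (A : Matrix (Fin p) (Fin K ⊕ Fin K) ℝ)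
    (Λ : Matrix (Fin K ⊕ Fin K) (Fin K ⊕ Fin K) ℝ)
    (s : Fin K ⊕ Fin K → ℝ) (hs : ∀ i, s i ≠ 0)
    (hdiag : (Aᵀ * A).IsDiag)
    (hsign : ∀ δ : Fin K ⊕ Fin K → ℝ, (∀ i, 0 ≤ δ i) →
      ∀ i, 0 ≤ s i * (Λ *ᵥ δ) i) :
    ∀ δ : Fin K ⊕ Fin K → ℝ, (∀ i, 0 ≤ δ i) →
      ∑ j, ((A *ᵥ s) j) ^ 2 ≤ ∑ j, ((A *ᵥ (s + Λ *ᵥ δ)) j) ^ 2 := by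
  intro δ hδ
  rw [sum_sq_mulVec_of_isDiag hdiag, sum_sq_mulVec_of_isDiag hdiag]
  refine Finset.sum_le_sum fun i _ => mul_le_mul_of_nonneg_left ?_ ?_
  · rw [Pi.add_apply]
    nlinarith [hsign δ hδ i, sq_nonneg ((Λ *ᵥ δ) i)]
  · rw [mul_apply]
    exact Finset.sum_nonneg fun j _ => mul_self_nonneg (A j i)
end

section
/- Let K ≤ N be positive integers, H ∈ ℝ^{2K×2N} with H·Hᵀ invertible, and set H† = Hᵀ(HHᵀ)⁻¹. Let τ₁,…,τ_K > 0, Θ = I₂ ⊗ diag(τ₁,…,τ_K), P_T > 0, and s ∈ ℝ^{2K} with s_i ≠ 0 for all i. Let Λ ∈ ℝ^{2K×2K} be invertible, of block form fromBlocks M_R N_R M_I N_I with all four blocks diagonal, and assume that Λ⁻¹(D·s) ⪰ 0 for every diagonal matrix D ∈ ℝ^{2K×2K} with nonnegative entries. Let δ* ⪰ 0 be a minimizer of δ ↦ ‖H†Θ(s + Λδ)‖₂² over {δ ∈ ℝ^{2K} : δ ⪰ 0}, and assume H†Θ(s + Λδ*) ≠ 0. Define t = √(P_T / ‖H†Θ(s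 + Λδ*)‖₂²), γ*_k = t·τ_k for each k, and x* = t·H†Θ(s + Λδ*). Then (x*, δ*, γ*) is feasible for the problem: maximize min_k γ_k²/τ_k² over x ∈ ℝ^{2N}, δ ⪰ 0, and γ ∈ ℝ^K with all γ_k > 0, subject to H·x = (I₂⊗diag(γ))·(s + Λδ) and ‖x‖₂² = P_T; and it attains the maximum value, which equals P_T / ‖H†Θ(s + Λδ*)‖₂². -/
open Matrix

/-- Applying the right pseudo-inverse `Hᵀ(HHᵀ)⁻¹` after `H` does not increase the sum of squares. -/
theorem sum_sq_pinv_mulVec_le {m n : Type*} [Fintype m] [DecidableEq m] [Fintype n]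
    (H : Matrix m n ℝ) (hH : IsUnit (H * Hᵀ)) (x : n → ℝ) :
    ∑ j, (((Hᵀ * (H * Hᵀ)⁻¹) *ᵥ (H *ᵥ x)) j) ^ 2 ≤ ∑ j, x j ^ 2 := by
  have hdet := (Matrix.isUnit_iff_isUnit_det _).mp hH
  set w := (H * Hᵀ)⁻¹ *ᵥ (H *ᵥ x) with hw
  set p := (Hᵀ * (H * Hᵀ)⁻¹) *ᵥ (H *ᵥ x) with hp
  have hpw : p = Hᵀ *ᵥ w := (Matrix.mulVec_mulVec _ _ _).symm
  have hHp : H *ᵥ p = H *ᵥ x := by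
    rw [hp, Matrix.mulVec_mulVec, ← Matrix.mul_assoc, Matrix.mul_nonsing_inv _ hdet,
      Matrix.one_mulVec]
  have horth : p ⬝ᵥ (x - p) = 0 := by
    nth_rewrite 1 [hpw]
    rw [Matrix.mulVec_transpose, ← Matrix.dotProduct_mulVec, Matrix.mulVec_sub, hHp, sub_self,
      dotProduct_zero]
  have hsum : ∑ j, x j ^ 2 = ∑ j, p j ^ 2 + 2 * (p ⬝ᵥ (x - p)) + ∑ j, (x j - p j) ^ 2 := by
    simp only [dotProduct, Finset.mul_sum, ← Finset.sum_add_distrib, Pi.sub_apply]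
    exact Finset.sum_congr rfl fun j _ => by ring
  have hnonneg : 0 ≤ ∑ j, (x j - p j) ^ 2 := Finset.sum_nonneg fun j _ => sq_nonneg _
  rw [horth] at hsum
  linarith

/-- A block matrix with diagonal blocks commutes with `I₂ ⊗ diag(c)`. -/
theorem commute_fromBlocks_isDiag_diagonal {k : Type*} [Fintype k] [DecidableEq k]
    {A B C D : Matrix k k ℝ} (hA : A.IsDiag) (hB : B.IsDiag) (hC : C.IsDiag) (hD : D.IsDiag)
    (c : k → ℝ) :
    Commute (Matrix.fromBlocks A B C D) (Matrix.diagonal (Sum.elim c c)) := by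
  rw [← Matrix.fromBlocks_diagonal, ← hA.diagonal_diag, ← hB.diagonal_diag,
    ← hC.diagonal_diag, ← hD.diagonal_diag]
  simp only [Commute, SemiconjBy, Matrix.fromBlocks_multiply, Matrix.diagonal_mul_diagonal,
    Matrix.zero_mul, Matrix.mul_zero, add_zero, zero_add, mul_comm]

/-- Scaling a point `s + Λδ` of the shifted cone by factors at least one stays in it. -/
theorem exists_nonneg_add_mulVec_eq_diagonal_mulVec {ι : Type*} [Fintype ι] [DecidableEq ι]
    {Λ : Matrix ι ι ℝ} (hΛ : IsUnit Λ) {s : ι → ℝ}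
    (hcone : ∀ d : ι → ℝ, (∀ i, 0 ≤ d i) → ∀ i, 0 ≤ (Λ⁻¹ *ᵥ (Matrix.diagonal d *ᵥ s)) i)
    {c : ι → ℝ} (hc : ∀ i, 1 ≤ c i) (hcomm : Commute Λ (Matrix.diagonal c))
    {δ : ι → ℝ} (hδ : ∀ i, 0 ≤ δ i) :
    ∃ δ' : ι → ℝ, (∀ i, 0 ≤ δ' i) ∧ s + Λ *ᵥ δ' = Matrix.diagonal c *ᵥ (s + Λ *ᵥ δ) := by
  have hdet := (Matrix.isUnit_iff_isUnit_det _).mp hΛ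
  refine ⟨Λ⁻¹ *ᵥ (Matrix.diagonal (fun i => c i - 1) *ᵥ s) + Matrix.diagonal c *ᵥ δ,
    fun i => ?_, ?_⟩
  · have h := hcone (fun i => c i - 1) (fun i => sub_nonneg.mpr (hc i)) i
    rw [Pi.add_apply, Matrix.mulVec_diagonal]
    exact add_nonneg h (mul_nonneg (zero_le_one.trans (hc i)) (hδ i))
  · rw [Matrix.mulVec_add, Matrix.mulVec_mulVec, Matrix.mul_nonsing_inv _ hdet,
      Matrix.one_mulVec, Matrix.mulVec_mulVec, hcomm.eq, Matrix.mulVec_add,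
      ← Matrix.mulVec_mulVec]
    ext i
    simp only [Pi.add_apply, Matrix.mulVec_diagonal]
    ring

/-- Proposition 2: the closed-form point built from a minimizer `δ*` of the NNLS
problem is feasible for the simplified SINR balancing problem and attains its maximum value
`P_T / ‖H†Θ(s + Λδ*)‖₂²`. -/
theorem stmt7 {K N : ℕ} (hK : 0 < K) (hKN : K ≤ N)
    (H : Matrix (Fin K ⊕ Fin K) (Fin N ⊕ Fin N) ℝ)
    (hHHT : IsUnit (H * Hᵀ))
    (Hdag : Matrix (Fin N ⊕ Fin N) (Fin K ⊕ Fin K) ℝ)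
    (hHdag : Hdag = Hᵀ * (H * Hᵀ)⁻¹)
    (τ : Fin K → ℝ) (hτ : ∀ k, 0 < τ k)
    (Θ : Matrix (Fin K ⊕ Fin K) (Fin K ⊕ Fin K) ℝ)
    (hΘ : Θ = Matrix.fromBlocks (Matrix.diagonal τ) 0 0 (Matrix.diagonal τ))
    (PT : ℝ) (hPT : 0 < PT)
    (s : Fin K ⊕ Fin K → ℝ) (hs : ∀ i, s i ≠ 0)
    (Λ : Matrix (Fin K ⊕ Fin K) (Fin K ⊕ Fin K) ℝ) (hΛ : IsUnit Λ)
    (hΛblock : ∃ MR NR MI NI : Matrix (Fin K) (Fin K) ℝ,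
      MR.IsDiag ∧ NR.IsDiag ∧ MI.IsDiag ∧ NI.IsDiag ∧
        Λ = Matrix.fromBlocks MR NR MI NI)
    (hcone : ∀ d : Fin K ⊕ Fin K → ℝ, (∀ i, 0 ≤ d i) →
      ∀ i, 0 ≤ (Λ⁻¹ *ᵥ ((Matrix.diagonal d) *ᵥ s)) i)
    (obj : (Fin K ⊕ Fin K → ℝ) → ℝ)
    (hobj : ∀ δ, obj δ = ∑ j, ((Hdag *ᵥ (Θ *ᵥ (s + Λ *ᵥ δ))) j) ^ 2)
    (δs : Fin K ⊕ Fin K → ℝ) (hδs : ∀ i, 0 ≤ δs i)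
    (hmin : ∀ δ : Fin K ⊕ Fin K → ℝ, (∀ i, 0 ≤ δ i) → obj δs ≤ obj δ)
    (hne : Hdag *ᵥ (Θ *ᵥ (s + Λ *ᵥ δs)) ≠ 0)
    (t : ℝ) (ht : t = Real.sqrt (PT / obj δs))
    (γs : Fin K → ℝ) (hγs : ∀ k, γs k = t * τ k)
    (xs : Fin N ⊕ Fin N → ℝ) (hxs : xs = t • (Hdag *ᵥ (Θ *ᵥ (s + Λ *ᵥ δs)))) :
    ((∀ k, 0 < γs k) ∧
      H *ᵥ xs =
        (Matrix.fromBlocks (Matrix.diagonal γs) 0 0 (Matrix.diagonal γs)) *ᵥ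
          (s + Λ *ᵥ δs) ∧
      ∑ i, xs i ^ 2 = PT) ∧
    (∀ (x : Fin N ⊕ Fin N → ℝ) (δ : Fin K ⊕ Fin K → ℝ) (γ : Fin K → ℝ),
      (∀ i, 0 ≤ δ i) → (∀ k, 0 < γ k) →
      H *ᵥ x =
        (Matrix.fromBlocks (Matrix.diagonal γ) 0 0 (Matrix.diagonal γ)) *ᵥ
          (s + Λ *ᵥ δ) →
      ∑ i, x i ^ 2 = PT →
      (⨅ k : Fin K, γ k ^ 2 / τ k ^ 2) ≤ ⨅ k : Fin K, γs k ^ 2 / τ k ^ 2) ∧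
    (⨅ k : Fin K, γs k ^ 2 / τ k ^ 2) = PT / obj δs := by
  have : Nonempty (Fin K) := ⟨⟨0, hK⟩⟩
  have hdet := (Matrix.isUnit_iff_isUnit_det _).mp hHHT
  have hobj_pos : 0 < obj δs := by
    rw [hobj]
    obtain ⟨j, hj⟩ := Function.ne_iff.mp hne
    exact Finset.sum_pos' (fun i _ => sq_nonneg _) ⟨j, Finset.mem_univ j, sq_pos_of_ne_zero hj⟩
  have hquot : 0 < PT / obj δs := div_pos hPT hobj_pos
  have ht_pos : 0 < t := ht ▸ Real.sqrt_pos.mpr hquot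
  have ht_sq : t ^ 2 = PT / obj δs := ht ▸ Real.sq_sqrt hquot.le
  have hval : (⨅ k : Fin K, γs k ^ 2 / τ k ^ 2) = PT / obj δs := by
    have h : ∀ k, γs k ^ 2 / τ k ^ 2 = PT / obj δs := fun k => by
      rw [hγs, mul_pow, mul_div_assoc, div_self (pow_ne_zero 2 (hτ k).ne'), mul_one, ht_sq]
    simp only [h, ciInf_const]
  refine ⟨⟨fun k => hγs k ▸ mul_pos ht_pos (hτ k), ?_, ?_⟩, ?_, hval⟩
  · rw [hxs, Matrix.mulVec_smul, Matrix.mulVec_mulVec, hHdag, ← Matrix.mul_assoc,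
      Matrix.mul_nonsing_inv _ hdet, Matrix.one_mulVec, hΘ, Matrix.fromBlocks_diagonal,
      Matrix.fromBlocks_diagonal]
    ext (i | i) <;> simp [Matrix.mulVec_diagonal, hγs, mul_assoc]
  · simp only [hxs, Pi.smul_apply, smul_eq_mul, mul_pow]
    rw [← Finset.mul_sum, ← hobj, ht_sq, div_mul_cancel₀ _ hobj_pos.ne']
  · intro x δ γ hδ hγ hHx hx
    rw [hval]
    obtain ⟨k₀, hk₀⟩ := exists_eq_ciInf_of_finite (f := fun k : Fin K => γ k ^ 2 / τ k ^ 2)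
    set a := γ k₀ / τ k₀ with ha
    have ha_pos : 0 < a := div_pos (hγ k₀) (hτ k₀)
    have ha_le : ∀ k, a ≤ γ k / τ k := fun k => by
      have h : γ k₀ ^ 2 / τ k₀ ^ 2 ≤ γ k ^ 2 / τ k ^ 2 :=
        hk₀.trans_le (ciInf_le (Set.finite_range _).bddBelow k)
      rw [← div_pow, ← div_pow] at h
      exact (sq_le_sq₀ ha_pos.le (div_pos (hγ k) (hτ k)).le).mp h
    set c : Fin K → ℝ := fun k => a⁻¹ * (γ k / τ k) with hc
    have hc_one : ∀ i, 1 ≤ Sum.elim c c i := by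
      have h : ∀ k, 1 ≤ c k := fun k => by
        rw [hc, ← inv_mul_cancel₀ ha_pos.ne']
        exact mul_le_mul_of_nonneg_left (ha_le k) (inv_nonneg.mpr ha_pos.le)
      rintro (k | k) <;> exact h k
    obtain ⟨MR, NR, MI, NI, hMR, hNR, hMI, hNI, hΛeq⟩ := hΛblock
    obtain ⟨δ', hδ', hδ'_eq⟩ := exists_nonneg_add_mulVec_eq_diagonal_mulVec hΛ hcone hc_one
      (hΛeq ▸ commute_fromBlocks_isDiag_diagonal hMR hNR hMI hNI c) hδ
    have hΘx : Θ *ᵥ (s + Λ *ᵥ δ') = a⁻¹ • (H *ᵥ x) := by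
      have h : ∀ k, τ k * c k = a⁻¹ * γ k := fun k => by
        have := (hτ k).ne'
        simp only [hc]
        field_simp
      rw [hδ'_eq, hHx, hΘ, Matrix.fromBlocks_diagonal, Matrix.fromBlocks_diagonal]
      ext (i | i) <;>
        simp only [Matrix.mulVec_diagonal, Pi.smul_apply, smul_eq_mul, Sum.elim_inl,
          Sum.elim_inr, ← mul_assoc, h]
    have hle : obj δs ≤ (a⁻¹) ^ 2 * PT := by
      refine (hmin δ' hδ').trans ?_
      rw [hobj, hΘx, Matrix.mulVec_smul, hHdag, ← hx]
      simp only [Pi.smul_apply, smul_eq_mul, mul_pow]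
      rw [← Finset.mul_sum]
      exact mul_le_mul_of_nonneg_left (sum_sq_pinv_mulVec_le H hHHT x) (sq_nonneg _)
    rw [← hk₀, ← div_pow, ← ha, le_div_iff₀ hobj_pos]
    calc a ^ 2 * obj δs ≤ a ^ 2 * ((a⁻¹) ^ 2 * PT) :=
          mul_le_mul_of_nonneg_left hle (sq_nonneg _)
      _ = PT := by field_simp
end

section
/- Let K, N be positive integers, H ∈ ℝ^{2K×2N}, ψ₁,…,ψ_K > 0, Ψ = I₂ ⊗ diag(ψ₁,…,ψ_K), σ² > 0, P_T > 0, β_k ≥ 0, and let E_k ∈ ℝ^{2N×2N} be symmetric positive semidefinite for k = 1,…,K. Define c = (σ²·Σ_{k=1}^K ψ_k²)/P_T, Υ = Σ_{k=1}^K ψ_k²β_k²E_k, Q = HᵀΨ²H + Υ + c·I_{2N} (which is symmetric positive definite), and P = Q⁻¹HᵀΨ. Fix s̃ ∈ ℝ^{2K} with P·s̃ ≠ 0, and define f(x,η) = ‖ΨHx‖₂²/η² − (2/η)·s̃ᵀΨHx + ‖s̃‖₂² + (1/η²)·Σ_{k=1}^K ψ_k²(β_k²·xᵀE_k x + σ²).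 Set η* = √(P_T/‖P·s̃‖₂²) and x* = η*·P·s̃. Then ‖x*‖₂² = P_T, η* > 0, and f(x*,η*) ≤ f(x,η) for every x ∈ ℝ^{2N} with ‖x‖₂² = P_T and every η > 0. -/
open Matrix

/-- A positive definite quadratic function `z ↦ zᵀQz - 2 zᵀQp` is minimized at `p`. -/
theorem Matrix.PosDef.quadratic_sub_linear_le {n : Type*} [Fintype n]
    {Q : Matrix n n ℝ} (hQ : Q.PosDef) (p z : n → ℝ) :
    p ⬝ᵥ (Q *ᵥ p) - 2 * (p ⬝ᵥ (Q *ᵥ p)) ≤ z ⬝ᵥ (Q *ᵥ z) - 2 * (z ⬝ᵥ (Q *ᵥ p)) := by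
  have hnonneg := hQ.posSemidef.dotProduct_mulVec_nonneg (z - p)
  have hsymm : p ⬝ᵥ (Q *ᵥ z) = z ⬝ᵥ (Q *ᵥ p) := by
    have hT : Qᵀ = Q := by simpa [IsHermitian] using hQ.isHermitian
    rw [dotProduct_mulVec, ← mulVec_transpose, hT, dotProduct_comm]
  simp only [star_trivial, mulVec_sub, dotProduct_sub, sub_dotProduct] at hnonneg
  linarith

/-- The quadratic form of a regularized, weighted Gram matrix. -/
theorem dotProduct_gram_add_sum_add_smul_one_mulVec {m n ι : Type*} [Fintype m] [DecidableEq m]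
    [Fintype n] [DecidableEq n] [Fintype ι] (H : Matrix m n ℝ) {W : Matrix m m ℝ} (hW : Wᵀ = W)
    (w : ι → ℝ) (E : ι → Matrix n n ℝ) (c : ℝ) (x : n → ℝ) :
    x ⬝ᵥ ((Hᵀ * W ^ 2 * H + ∑ k, w k • E k + c • (1 : Matrix n n ℝ)) *ᵥ x) =
      ∑ i, (((W * H) *ᵥ x) i) ^ 2 + ∑ k, w k * (x ⬝ᵥ (E k *ᵥ x)) + c * ∑ i, x i ^ 2 := by
  have hgram : Hᵀ * W ^ 2 * H = (W * H)ᵀ * (W * H) := by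
    rw [transpose_mul, hW, pow_two]
    simp only [Matrix.mul_assoc]
  rw [hgram, add_mulVec, add_mulVec, dotProduct_add, dotProduct_add, sum_mulVec, dotProduct_sum,
    ← mulVec_mulVec, dotProduct_mulVec, vecMul_transpose]
  simp only [smul_mulVec, one_mulVec, dotProduct_smul, smul_eq_mul]
  simp only [dotProduct, pow_two]

/-- Proposition 4: `Q` is positive definite, and the closed-form point
`x* = η*·P·s̃`, `η* = √(P_T/‖P·s̃‖₂²)` minimizes the MSE objective `f` over all `x` with
`‖x‖₂² = P_T` and all `η > 0`. -/
theorem stmt8 {K N : ℕ} (hK : 0 < K) (hN : 0 < N)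
    (H : Matrix (Fin K ⊕ Fin K) (Fin N ⊕ Fin N) ℝ)
    (ψ : Fin K → ℝ) (hψ : ∀ k, 0 < ψ k)
    (Ψ : Matrix (Fin K ⊕ Fin K) (Fin K ⊕ Fin K) ℝ)
    (hΨ : Ψ = Matrix.fromBlocks (Matrix.diagonal ψ) 0 0 (Matrix.diagonal ψ))
    (σ2 PT : ℝ) (hσ : 0 < σ2) (hPT : 0 < PT)
    (β : Fin K → ℝ) (hβ : ∀ k, 0 ≤ β k)
    (E : Fin K → Matrix (Fin N ⊕ Fin N) (Fin N ⊕ Fin N) ℝ)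
    (hE : ∀ k, (E k).PosSemidef)
    (c : ℝ) (hc : c = σ2 * (∑ k, ψ k ^ 2) / PT)
    (Υ : Matrix (Fin N ⊕ Fin N) (Fin N ⊕ Fin N) ℝ)
    (hΥ : Υ = ∑ k, (ψ k ^ 2 * β k ^ 2) • E k)
    (Q : Matrix (Fin N ⊕ Fin N) (Fin N ⊕ Fin N) ℝ)
    (hQ : Q = Hᵀ * Ψ ^ 2 * H + Υ + c • (1 : Matrix (Fin N ⊕ Fin N) (Fin N ⊕ Fin N) ℝ))
    (P : Matrix (Fin N ⊕ Fin N) (Fin K ⊕ Fin K) ℝ)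
    (hP : P = Q⁻¹ * Hᵀ * Ψ)
    (st : Fin K ⊕ Fin K → ℝ) (hst : P *ᵥ st ≠ 0)
    (f : (Fin N ⊕ Fin N → ℝ) → ℝ → ℝ)
    (hf : ∀ x η, f x η =
      (∑ i, (((Ψ * H) *ᵥ x) i) ^ 2) / η ^ 2
        - (2 / η) * (st ⬝ᵥ ((Ψ * H) *ᵥ x))
        + (∑ i, st i ^ 2)
        + (1 / η ^ 2) * ∑ k, ψ k ^ 2 * (β k ^ 2 * (x ⬝ᵥ (E k *ᵥ x)) + σ2))
    (ηs : ℝ) (hηs : ηs = Real.sqrt (PT / ∑ i, ((P *ᵥ st) i) ^ 2))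
    (xs : Fin N ⊕ Fin N → ℝ) (hxs : xs = ηs • (P *ᵥ st)) :
    Q.PosDef ∧ (∑ i, xs i ^ 2 = PT) ∧ 0 < ηs ∧
      ∀ (x : Fin N ⊕ Fin N → ℝ) (η : ℝ), (∑ i, x i ^ 2 = PT) → 0 < η →
        f xs ηs ≤ f x η := by
  have hΨT : Ψᵀ = Ψ := by
    rw [hΨ, fromBlocks_transpose]
    simp
  have hquad (x : Fin N ⊕ Fin N → ℝ) : x ⬝ᵥ (Q *ᵥ x) = ∑ i, (((Ψ * H) *ᵥ x) i) ^ 2 +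
      ∑ k, ψ k ^ 2 * β k ^ 2 * (x ⬝ᵥ (E k *ᵥ x)) + c * ∑ i, x i ^ 2 := by
    rw [hQ, hΥ, dotProduct_gram_add_sum_add_smul_one_mulVec H hΨT]
  have hψ_sum : 0 < ∑ k, ψ k ^ 2 :=
    Finset.sum_pos (fun k _ => pow_pos (hψ k) 2) ⟨⟨0, hK⟩, Finset.mem_univ _⟩
  have hc_pos : 0 < c := by
    rw [hc]
    positivity
  have hQ_pos : Q.PosDef := by
    have hgram : Hᵀ * Ψ ^ 2 * H = (Ψ * H)ᴴ * (Ψ * H) := by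
      rw [conjTranspose_eq_transpose_of_trivial, transpose_mul, hΨT, pow_two]
      simp only [Matrix.mul_assoc]
    rw [hQ, hΥ, hgram]
    refine PosDef.posSemidef_add ?_ (PosDef.one.smul hc_pos)
    exact (posSemidef_conjTranspose_mul_self _).add
      (posSemidef_sum _ fun k _ => (hE k).smul (by positivity))
  set p := P *ᵥ st with hp
  have hQp : Q *ᵥ p = (Ψ * H)ᵀ *ᵥ st := by
    rw [hp, hP, mulVec_mulVec, Matrix.mul_assoc, ← Matrix.mul_assoc,
      mul_nonsing_inv _ ((isUnit_iff_isUnit_det _).mp hQ_pos.isUnit), Matrix.one_mul,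
      transpose_mul, hΨT]
  have hp_pos : 0 < ∑ i, p i ^ 2 := by
    obtain ⟨i, hi⟩ := Function.ne_iff.mp hst
    exact Finset.sum_pos' (fun j _ => sq_nonneg (p j)) ⟨i, Finset.mem_univ i, sq_pos_of_ne_zero hi⟩
  have hηs_pos : 0 < ηs := by
    rw [hηs]
    positivity
  have hxs_norm : ∑ i, xs i ^ 2 = PT := by
    have hsq : ηs ^ 2 = PT / ∑ i, p i ^ 2 := by
      rw [hηs, Real.sq_sqrt (by positivity)]
    simp only [hxs, Pi.smul_apply, smul_eq_mul, mul_pow]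
    rw [← Finset.mul_sum, hsq]
    field_simp
  have hf_quad (x : Fin N ⊕ Fin N → ℝ) (η : ℝ) (hx : ∑ i, x i ^ 2 = PT) (hη : 0 < η) :
      f x η = (η⁻¹ • x) ⬝ᵥ (Q *ᵥ (η⁻¹ • x)) - 2 * ((η⁻¹ • x) ⬝ᵥ (Q *ᵥ p))
        + ∑ i, st i ^ 2 := by
    have hcPT : c * PT = σ2 * ∑ k, ψ k ^ 2 := by
      rw [hc]
      field_simp
    have hlin : x ⬝ᵥ (Q *ᵥ p) = st ⬝ᵥ ((Ψ * H) *ᵥ x) := by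
      rw [hQp, dotProduct_mulVec, vecMul_transpose, dotProduct_comm]
    have hnoise : ∑ k, ψ k ^ 2 * (β k ^ 2 * (x ⬝ᵥ (E k *ᵥ x)) + σ2) =
        ∑ k, ψ k ^ 2 * β k ^ 2 * (x ⬝ᵥ (E k *ᵥ x)) + σ2 * ∑ k, ψ k ^ 2 := by
      rw [Finset.mul_sum, ← Finset.sum_add_distrib]
      exact Finset.sum_congr rfl fun k _ => by ring
    rw [hf, hnoise, mulVec_smul, dotProduct_smul, smul_dotProduct, smul_dotProduct, hquad, hlin,
      hx, hcPT]
    simp only [smul_eq_mul]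
    field_simp
    ring
  refine ⟨hQ_pos, hxs_norm, hηs_pos, fun x η hx hη => ?_⟩
  have hxs_scaled : ηs⁻¹ • xs = p := by
    rw [hxs, inv_smul_smul₀ hηs_pos.ne']
  rw [hf_quad xs ηs hxs_norm hηs_pos, hf_quad x η hx hη, hxs_scaled]
  gcongr ?_ + _
  exact hQ_pos.quadratic_sub_linear_le p _
end

section
/- Under the setting of the MMSE subproblem: K, N positive integers, H ∈ ℝ^{2K×2N}, ψ₁,…,ψ_K > 0, Ψ = I₂ ⊗ diag(ψ₁,…,ψ_K), σ² > 0, P_T > 0, β_k ≥ 0, E_k ∈ ℝ^{2N×2N} symmetric positive semidefinite, c = (σ²·Σ_k ψ_k²)/P_T, Υ = Σ_k ψ_k²β_k²E_k, Q = HᵀΨ²H + Υ + c·I_{2N}, P = Q⁻¹HᵀΨ, f(x,η) = ‖ΨHx‖₂²/η² − (2/η)·s̃ᵀΨHx + ‖s̃‖₂² + (1/η²)·Σ_k ψ_k²(β_k²·xᵀE_k x + σ²). For any s̃ ∈ ℝ^{2K} with P·s̃ ≠ 0, setting η* = √(P_T/‖P·s̃‖₂²) and x* = η*·P·s̃, the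 value of the objective satisfies f(x*, η*) = s̃ᵀ(I_{2K} − ΨHP)s̃. -/
open Matrix

/-- For invertible `Q` and `P = Q⁻¹ Aᵀ`, the quadratic form of `Q` at `P s` is `sᵀ A P s`. -/
theorem dotProduct_mulVec_inv_mul_transpose {m n : Type*} [Fintype m] [Fintype n] [DecidableEq n]
    (A : Matrix m n ℝ) {Q : Matrix n n ℝ} (hQ : IsUnit Q.det) (s : m → ℝ) :
    ((Q⁻¹ * Aᵀ) *ᵥ s) ⬝ᵥ (Q *ᵥ ((Q⁻¹ * Aᵀ) *ᵥ s)) = s ⬝ᵥ (A *ᵥ ((Q⁻¹ * Aᵀ) *ᵥ s)) := by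
  have h : Q *ᵥ ((Q⁻¹ * Aᵀ) *ᵥ s) = Aᵀ *ᵥ s := by
    rw [mulVec_mulVec, mul_nonsing_inv_cancel_left _ _ hQ]
  rw [h, mulVec_transpose, dotProduct_comm, ← dotProduct_mulVec]

/-- Substituting the closed-form optimum `x* = η*·P·s̃`, `η* = √(P_T/‖P·s̃‖₂²)`
into the MSE objective gives `f(x*,η*) = s̃ᵀ(I − ΨHP)s̃`. -/
theorem stmt9 {K N : ℕ} (hK : 0 < K) (hN : 0 < N)
    (H : Matrix (Fin K ⊕ Fin K) (Fin N ⊕ Fin N) ℝ)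
    (ψ : Fin K → ℝ) (hψ : ∀ k, 0 < ψ k)
    (Ψ : Matrix (Fin K ⊕ Fin K) (Fin K ⊕ Fin K) ℝ)
    (hΨ : Ψ = Matrix.fromBlocks (Matrix.diagonal ψ) 0 0 (Matrix.diagonal ψ))
    (σ2 PT : ℝ) (hσ : 0 < σ2) (hPT : 0 < PT)
    (β : Fin K → ℝ) (hβ : ∀ k, 0 ≤ β k)
    (E : Fin K → Matrix (Fin N ⊕ Fin N) (Fin N ⊕ Fin N) ℝ)
    (hE : ∀ k, (E k).PosSemidef)
    (c : ℝ) (hc : c = σ2 * (∑ k, ψ k ^ 2) / PT)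
    (Υ : Matrix (Fin N ⊕ Fin N) (Fin N ⊕ Fin N) ℝ)
    (hΥ : Υ = ∑ k, (ψ k ^ 2 * β k ^ 2) • E k)
    (Q : Matrix (Fin N ⊕ Fin N) (Fin N ⊕ Fin N) ℝ)
    (hQ : Q = Hᵀ * Ψ ^ 2 * H + Υ + c • (1 : Matrix (Fin N ⊕ Fin N) (Fin N ⊕ Fin N) ℝ))
    (P : Matrix (Fin N ⊕ Fin N) (Fin K ⊕ Fin K) ℝ)
    (hP : P = Q⁻¹ * Hᵀ * Ψ)
    (st : Fin K ⊕ Fin K → ℝ) (hst : P *ᵥ st ≠ 0)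
    (f : (Fin N ⊕ Fin N → ℝ) → ℝ → ℝ)
    (hf : ∀ x η, f x η =
      (∑ i, (((Ψ * H) *ᵥ x) i) ^ 2) / η ^ 2
        - (2 / η) * (st ⬝ᵥ ((Ψ * H) *ᵥ x))
        + (∑ i, st i ^ 2)
        + (1 / η ^ 2) * ∑ k, ψ k ^ 2 * (β k ^ 2 * (x ⬝ᵥ (E k *ᵥ x)) + σ2))
    (ηs : ℝ) (hηs : ηs = Real.sqrt (PT / ∑ i, ((P *ᵥ st) i) ^ 2))
    (xs : Fin N ⊕ Fin N → ℝ) (hxs : xs = ηs • (P *ᵥ st)) :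
    f xs ηs = st ⬝ᵥ ((1 - Ψ * H * P) *ᵥ st) := by
  have hw : 0 < ∑ i, ((P *ᵥ st) i) ^ 2 := by
    obtain ⟨i, hi⟩ := Function.ne_iff.mp hst
    exact Finset.sum_pos' (fun j _ => sq_nonneg _) ⟨i, Finset.mem_univ i, sq_pos_of_ne_zero hi⟩
  have hη : 0 < ηs := hηs ▸ Real.sqrt_pos.mpr (div_pos hPT hw)
  have hη2 : ηs ^ 2 = PT / ∑ i, ((P *ᵥ st) i) ^ 2 := by
    rw [hηs, Real.sq_sqrt (div_pos hPT hw).le]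
  have hcpos : 0 < c := by
    have : Nonempty (Fin K) := ⟨⟨0, hK⟩⟩
    rw [hc]
    exact div_pos (mul_pos hσ (Finset.sum_pos (fun k _ => pow_pos (hψ k) 2)
      Finset.univ_nonempty)) hPT
  have hΨT : Ψᵀ = Ψ := by
    rw [hΨ, fromBlocks_transpose]; simp
  have hA : Hᵀ * Ψ ^ 2 * H = (Ψ * H)ᵀ * (Ψ * H) := by
    rw [transpose_mul, hΨT, pow_two]; simp only [Matrix.mul_assoc]
  have hQdet : IsUnit Q.det := by
    have hΥpsd : Υ.PosSemidef := by
      rw [hΥ]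
      exact posSemidef_sum _ fun k _ => (hE k).smul (by positivity)
    have hApsd : ((Ψ * H)ᵀ * (Ψ * H)).PosSemidef := by
      simpa using posSemidef_conjTranspose_mul_self (Ψ * H)
    rw [hQ, hA]
    exact ((PosDef.one.smul hcpos).posSemidef_add (hApsd.add hΥpsd)).det_pos.ne'.isUnit
  have hPA : P = Q⁻¹ * (Ψ * H)ᵀ := by
    rw [hP, transpose_mul, hΨT, Matrix.mul_assoc]
  have hquad := dotProduct_mulVec_inv_mul_transpose (Ψ * H) hQdet st
  rw [← hPA] at hquad
  have hrhs : st ⬝ᵥ ((1 - Ψ * H * P) *ᵥ st)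
      = ∑ i, st i ^ 2 - st ⬝ᵥ ((Ψ * H) *ᵥ (P *ᵥ st)) := by
    rw [sub_mulVec, one_mulVec, dotProduct_sub, mulVec_mulVec]
    simp only [dotProduct, pow_two]
  rw [hrhs, hf, hxs]
  generalize P *ᵥ st = w at *
  have hQw : w ⬝ᵥ (Q *ᵥ w) = ∑ i, ((Ψ * H) *ᵥ w) i ^ 2
      + ∑ k, ψ k ^ 2 * β k ^ 2 * (w ⬝ᵥ (E k *ᵥ w)) + c * ∑ i, w i ^ 2 := by
    rw [hQ, hA, hΥ, add_mulVec, add_mulVec, dotProduct_add, dotProduct_add, ← mulVec_mulVec,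
      dotProduct_mulVec, vecMul_transpose, sum_mulVec, dotProduct_sum]
    simp only [smul_mulVec, one_mulVec, dotProduct_smul, smul_eq_mul]
    simp only [dotProduct, pow_two]
  have hsq : ∑ i, ((Ψ * H) *ᵥ (ηs • w)) i ^ 2 = ηs ^ 2 * ∑ i, ((Ψ * H) *ᵥ w) i ^ 2 := by
    simp only [mulVec_smul, Pi.smul_apply, smul_eq_mul, mul_pow, Finset.mul_sum]
  have hnoise : ∑ k, ψ k ^ 2 * (β k ^ 2 * ((ηs • w) ⬝ᵥ (E k *ᵥ (ηs • w))) + σ2)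
      = ηs ^ 2 * (∑ k, ψ k ^ 2 * β k ^ 2 * (w ⬝ᵥ (E k *ᵥ w)) + c * ∑ i, w i ^ 2) := by
    have hcη : ηs ^ 2 * (c * ∑ i, w i ^ 2) = ∑ k, ψ k ^ 2 * σ2 := by
      rw [hη2, hc, ← Finset.sum_mul]
      field_simp
    rw [mul_add, hcη, Finset.mul_sum, ← Finset.sum_add_distrib]
    refine Finset.sum_congr rfl fun k _ => ?_
    simp only [mulVec_smul, dotProduct_smul, smul_dotProduct, smul_eq_mul]
    ring
  have hlin : 2 / ηs * (st ⬝ᵥ ((Ψ * H) *ᵥ (ηs • w))) = 2 * (st ⬝ᵥ ((Ψ * H) *ᵥ w)) := by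
    rw [mulVec_smul, dotProduct_smul, smul_eq_mul]
    field_simp
  have hη0 : ηs ^ 2 ≠ 0 := (pow_pos hη 2).ne'
  rw [hsq, hnoise, hlin, mul_div_cancel_left₀ _ hη0, ← mul_assoc, one_div_mul_cancel hη0]
  linarith
end
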